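/- Let W₁, W₂ be independent standard Brownian motions. With X̄_i = ∫_0^1 W_i(u) du, Y_ij = ∫_0^1 W_i(u) W_j(u) du − X̄_i X̄_j, and ρ = Y₁₂ / √(Y₁₁ Y₂₂), one has E[ρ²] = ∫_0^∞ ∫_0^v ( u v √(u v) / ( (v² − u²) √( sinh u · sinh v ) ) ) · ( 1/(u tanh u) − 1/(v tanh v) − 1/u² + 1/v² ) du dv. -/

import Mathlib

open MeasureTheory ProbabilityTheory Filter

/-- `W` is a standard Brownian motion under `P`: it is measurable in `ω` for each time,
has continuous paths on `[0,∞)`, starts at `0`, and every finite linear combination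
`∑ i, c i * W (t i)` with times `t i ≥ 0` is a centered Gaussian with variance
`∑ i, ∑ j, c i * c j * min (t i) (t j)` (i.e. `W` is a centered Gaussian process with
covariance `Cov(W s, W t) = min s t`). -/
def IsStdBM {Ω : Type*} [MeasurableSpace Ω] (P : Measure Ω) (W : ℝ → Ω → ℝ) : Prop :=
  (∀ t : ℝ, Measurable (W t)) ∧
  (∀ ω, ContinuousOn (fun t => W t ω) (Set.Ici 0)) ∧
  (∀ ω, W 0 ω = 0) ∧
  ∀ (n : ℕ) (t : Fin n → ℝ) (c : Fin n → ℝ), (∀ i, 0 ≤ t i) →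
    P.map (fun ω => ∑ i, c i * W (t i) ω) =
      gaussianReal 0 (∑ i, ∑ j, c i * c j * min (t i) (t j)).toNNReal

open scoped Topology

/-- The frequency `(n + 1) π` of the `n`-th nonconstant cosine on `[0, 1]`. -/
noncomputable def cosFreq (n : ℕ) : ℝ := (n + 1) * Real.pi

lemma cosFreq_pos (n : ℕ) : 0 < cosFreq n := by
  unfold cosFreq; positivity

/-- The coefficient of `f` along the normalised cosine `√2 cos ((n + 1) π t)` on `[0, 1]`. -/
noncomputable def cosCoeff (n : ℕ) (f : ℝ → ℝ) : ℝ :=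
  √2 * ∫ t in (0:ℝ)..1, Real.cos (cosFreq n * t) * f t

lemma integral_comp_abs_symm {f : ℝ → ℝ} (hf : Continuous f) :
    ∫ x in (-1:ℝ)..1, f |x| = 2 * ∫ x in (0:ℝ)..1, f x := by
  have hc : Continuous fun x : ℝ => f |x| := by fun_prop
  rw [← intervalIntegral.integral_add_adjacent_intervals (b := 0)
    (hc.intervalIntegrable _ _) (hc.intervalIntegrable _ _), two_mul]
  congr 1
  · have h := intervalIntegral.integral_comp_neg (a := 0) (b := 1) fun x => f |x|
    rw [neg_zero] at h
    rw [← h]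
    refine intervalIntegral.integral_congr fun x hx => ?_
    rw [Set.uIcc_of_le zero_le_one] at hx
    simp [abs_of_nonneg hx.1]
  · refine intervalIntegral.integral_congr fun x hx => ?_
    rw [Set.uIcc_of_le zero_le_one] at hx
    simp [abs_of_nonneg hx.1]

lemma fourierCoeffOn_comp_abs {f : ℝ → ℝ} (hf : Continuous f) (n : ℤ) :
    fourierCoeffOn (show (-1:ℝ) < 1 by norm_num) (fun x => (f |x| : ℂ)) n
      = ((∫ t in (0:ℝ)..1, Real.cos (n * Real.pi * t) * f t : ℝ) : ℂ) := by
  have hE (x : ℝ) : fourier (-n) (x : AddCircle (1 - (-1 : ℝ))) • (f |x| : ℂ)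
      = ((Real.cos (n * Real.pi * |x|) * f |x| : ℝ) : ℂ)
        + Complex.I * ((- Real.sin (n * Real.pi * x) * f |x| : ℝ) : ℂ) := by
    have hcos : Real.cos (n * Real.pi * |x|) = Real.cos (n * Real.pi * x) := by
      rcases abs_choice x with h | h <;> rw [h]
      rw [mul_neg, Real.cos_neg]
    rw [hcos, fourier_coe_apply, smul_eq_mul]
    have : 2 * Real.pi * Complex.I * ((-n : ℤ) : ℂ) * x / ((1 - (-1) : ℝ) : ℂ)
        = ((-(n * Real.pi * x) : ℝ) : ℂ) * Complex.I := by
      push_cast; ring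
    rw [this, Complex.exp_mul_I, ← Complex.ofReal_cos, ← Complex.ofReal_sin, Real.cos_neg,
      Real.sin_neg]
    push_cast; ring
  have hodd : ∫ x in (-1:ℝ)..1, (- Real.sin (n * Real.pi * x) * f |x|) = 0 := by
    have h := intervalIntegral.integral_comp_neg (a := -1) (b := 1)
      fun x => (- Real.sin (n * Real.pi * x) * f |x|)
    simp only [mul_neg, Real.sin_neg, abs_neg, neg_neg] at h
    have h2 : ∫ x in (-1:ℝ)..1, (- Real.sin (n * Real.pi * x) * f |x|)
        = - ∫ x in (-1:ℝ)..1, (Real.sin (n * Real.pi * x) * f |x|) := by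
      rw [← intervalIntegral.integral_neg]; simp
    linarith
  rw [fourierCoeffOn_eq_integral]
  simp_rw [hE]
  rw [intervalIntegral.integral_add, intervalIntegral.integral_const_mul,
    intervalIntegral.integral_ofReal, intervalIntegral.integral_ofReal, hodd,
    integral_comp_abs_symm (f := fun x => Real.cos (n * Real.pi * x) * f x) (by fun_prop)]
  · push_cast
    rw [Complex.real_smul]
    push_cast
    ring
  · exact Continuous.intervalIntegrable (by fun_prop) _ _
  · exact Continuous.intervalIntegrable (by fun_prop) _ _

/-- The Parseval identity for the cosine basis of `L²[0, 1]`. -/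
lemma hasSum_cosCoeff_sq {f : ℝ → ℝ} (hf : Continuous f) :
    HasSum (fun n => cosCoeff n f ^ 2)
      ((∫ t in (0:ℝ)..1, f t ^ 2) - (∫ t in (0:ℝ)..1, f t) ^ 2) := by
  have hc : Continuous fun x : ℝ => (f |x| : ℂ) := by fun_prop
  have hL2 : MemLp (fun x : ℝ => (f |x| : ℂ)) 2 (volume.restrict (Set.Ioc (-1) 1)) := by
    rw [memLp_two_iff_integrable_sq_norm hc.aestronglyMeasurable]
    exact Continuous.integrableOn_Ioc (by fun_prop)
  have h := hasSum_sq_fourierCoeffOn (show (-1:ℝ) < 1 by norm_num) hL2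
  simp_rw [fourierCoeffOn_comp_abs hf, Complex.norm_real, Real.norm_eq_abs, sq_abs] at h
  rw [integral_comp_abs_symm (f := fun x => f x ^ 2) (by fun_prop)] at h
  have h2 := h.nat_add_neg
  rw [← hasSum_nat_add_iff' 1] at h2
  simp only [Finset.sum_range_one] at h2
  convert! h2 using 1
  · funext n
    unfold cosCoeff cosFreq
    rw [mul_pow, Real.sq_sqrt zero_le_two]
    push_cast
    simp_rw [neg_mul, Real.cos_neg]
    ring
  · simp; ring

lemma cosCoeff_add {f g : ℝ → ℝ} (hf : Continuous f) (hg : Continuous g) (n : ℕ) :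
    cosCoeff n (fun t => f t + g t) = cosCoeff n f + cosCoeff n g := by
  unfold cosCoeff
  simp_rw [mul_add]
  rw [intervalIntegral.integral_add, mul_add] <;>
  exact Continuous.intervalIntegrable (by fun_prop) _ _

lemma hasSum_cosCoeff_mul {f g : ℝ → ℝ} (hf : Continuous f) (hg : Continuous g) :
    HasSum (fun n => cosCoeff n f * cosCoeff n g)
      ((∫ t in (0:ℝ)..1, f t * g t) - (∫ t in (0:ℝ)..1, f t) * ∫ t in (0:ℝ)..1, g t) := by
  have h := (((hasSum_cosCoeff_sq (hf.add hg)).sub (hasSum_cosCoeff_sq hf)).sub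
    (hasSum_cosCoeff_sq hg)).div_const 2
  convert! h using 1
  · funext n
    simp only [Pi.add_def]
    rw [cosCoeff_add hf hg]; ring
  · have e : ∫ t in (0:ℝ)..1, (f t + g t) ^ 2 = (∫ t in (0:ℝ)..1, f t ^ 2)
        + 2 * (∫ t in (0:ℝ)..1, f t * g t) + ∫ t in (0:ℝ)..1, g t ^ 2 := by
      rw [← intervalIntegral.integral_const_mul, ← intervalIntegral.integral_add,
        ← intervalIntegral.integral_add]
      · congr 1; funext t; ring
      all_goals exact Continuous.intervalIntegrable (by fun_prop) _ _
    have e2 : ∫ t in (0:ℝ)..1, (f t + g t) = (∫ t in (0:ℝ)..1, f t) + ∫ t in (0:ℝ)..1, g t := by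
      rw [← intervalIntegral.integral_add]
      all_goals exact Continuous.intervalIntegrable (by fun_prop) _ _
    simp only [Pi.add_apply, e, e2]
    ring

lemma tendsto_prod_one_add_sq_div_cosFreq_sq {u : ℝ} (hu : 0 < u) :
    Tendsto (fun K => ∏ k ∈ Finset.range K, (1 + u ^ 2 / cosFreq k ^ 2)) atTop
      (𝓝 (Real.sinh u / u)) := by
  have hpi : (Real.pi : ℂ) ≠ 0 := by exact_mod_cast Real.pi_ne_zero
  have hu' : (u : ℂ) ≠ 0 := by exact_mod_cast hu.ne'
  have hx : (u * Complex.I / Real.pi : ℂ) ≠ 0 := by simp [hu.ne', Real.pi_ne_zero]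
  have h := tendsto_euler_sin_prod' hx
  have e : (Real.pi : ℂ) * (u * Complex.I / Real.pi) = u * Complex.I := by field_simp
  rw [e, Complex.sin_mul_I, mul_div_mul_right _ _ Complex.I_ne_zero] at h
  have h2 := (Complex.continuous_re.tendsto _).comp h
  have e2 : (Complex.sinh u / u).re = Real.sinh u / u := by
    rw [← Complex.ofReal_sinh, ← Complex.ofReal_div, Complex.ofReal_re]
  rw [e2] at h2
  refine h2.congr fun K => ?_
  simp only [Function.comp]
  rw [← Complex.ofReal_re (∏ k ∈ Finset.range K, (1 + u ^ 2 / cosFreq k ^ 2))]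
  congr 1
  push_cast
  refine Finset.prod_congr rfl fun k _ => ?_
  have hk : ((k : ℂ) + 1) ≠ 0 := by exact_mod_cast k.succ_ne_zero
  unfold sineTerm cosFreq
  push_cast
  rw [div_pow, mul_pow, Complex.I_sq]
  field_simp

lemma mul_I_div_pi_mem_integerComplement {u : ℝ} (hu : 0 < u) :
    (u * Complex.I / Real.pi : ℂ) ∈ Complex.integerComplement := by
  rw [Complex.mem_integerComplement_iff]
  rintro ⟨n, hn⟩
  have := congrArg Complex.im hn
  have e : (u * Complex.I / Real.pi : ℂ) = ((u / Real.pi : ℝ) : ℂ) * Complex.I := by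
    push_cast; ring
  rw [e] at this
  simp only [Complex.intCast_im, Complex.im_ofReal_mul, Complex.I_im,
    mul_one] at this
  exact (div_pos hu Real.pi_pos).ne this

lemma hasSum_inv_cosFreq_sq_add_sq {u : ℝ} (hu : 0 < u) :
    HasSum (fun n => 1 / (cosFreq n ^ 2 + u ^ 2)) ((1 / (u * Real.tanh u) - 1 / u ^ 2) / 2) := by
  have hpi : (Real.pi : ℂ) ≠ 0 := by exact_mod_cast Real.pi_ne_zero
  have hu' : (u : ℂ) ≠ 0 := by exact_mod_cast hu.ne'
  have hx := mul_I_div_pi_mem_integerComplement hu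
  have h := (summable_cotTerm hx).hasSum
  have h0 := cot_series_rep' hx
  unfold cotTerm at h
  rw [← h0] at h
  have e : (Real.pi : ℂ) * (u * Complex.I / Real.pi) = u * Complex.I := by field_simp
  have h2 := h.div_const (-2 * u * Complex.I * Real.pi)
  rw [← Complex.hasSum_ofReal]
  convert! h2 using 1
  · funext n
    have hpos : 0 < cosFreq n ^ 2 + u ^ 2 := by positivity
    have hne : ((cosFreq n : ℂ) ^ 2 + u ^ 2) ≠ 0 := by exact_mod_cast hpos.ne'
    have hA : ((u * Complex.I / Real.pi : ℂ) - (n + 1)) ≠ 0 := by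
      have := Complex.integerComplement_add_ne_zero hx (-(n + 1 : ℤ))
      push_cast at this
      rwa [sub_eq_add_neg]
    have hB : ((u * Complex.I / Real.pi : ℂ) + (n + 1)) ≠ 0 := by
      have := Complex.integerComplement_add_ne_zero hx (n + 1 : ℤ)
      push_cast at this
      exact this
    have hAB : ((u * Complex.I / Real.pi : ℂ) - (n + 1)) * ((u * Complex.I / Real.pi : ℂ) + (n + 1))
        = -((cosFreq n : ℂ) ^ 2 + u ^ 2) / Real.pi ^ 2 := by
      unfold cosFreq
      push_cast
      field_simp
      linear_combination (u : ℂ) ^ 2 * Complex.I_sq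
    rw [div_add_div _ _ hA hB, hAB]
    push_cast
    field_simp
    ring
  · rw [e, Complex.cot_eq_cos_div_sin, Complex.cos_mul_I, Complex.sin_mul_I, Real.tanh_eq_sinh_div_cosh]
    have hs : Complex.sinh u ≠ 0 := by
      rw [← Complex.ofReal_sinh]; exact_mod_cast (Real.sinh_pos_iff.2 hu).ne'
    have hc : Complex.cosh u ≠ 0 := by
      rw [← Complex.ofReal_cosh]; exact_mod_cast (Real.cosh_pos u).ne'
    push_cast
    field_simp
    linear_combination (u * Complex.cosh u - Complex.sinh u) * Complex.I_sq

lemma hasSum_inv_mul_inv {u v : ℝ} (hu : 0 < u) (hv : 0 < v) (huv : u ≠ v) :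
    HasSum (fun n => 1 / (cosFreq n ^ 2 + u ^ 2) * (1 / (cosFreq n ^ 2 + v ^ 2)))
      ((1 / (u * Real.tanh u) - 1 / (v * Real.tanh v) - 1 / u ^ 2 + 1 / v ^ 2)
        / (2 * (v ^ 2 - u ^ 2))) := by
  have hne : v ^ 2 - u ^ 2 ≠ 0 := by
    rw [sub_ne_zero]
    intro h
    exact huv ((sq_eq_sq₀ hv.le hu.le).1 h).symm
  have h := ((hasSum_inv_cosFreq_sq_add_sq hu).sub (hasSum_inv_cosFreq_sq_add_sq hv)).div_const
    (v ^ 2 - u ^ 2)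
  convert! h using 1
  · funext n
    have h1 : cosFreq n ^ 2 + u ^ 2 ≠ 0 := by positivity
    have h2 : cosFreq n ^ 2 + v ^ 2 ≠ 0 := by positivity
    field_simp
    ring
  · field_simp
    ring

/-- Tilting a centered Gaussian of variance `v` by `exp (-a x ^ 2 / 2)` gives, up to the
normalisation `(1 + a v) ^ (-1/2)`, a centered Gaussian of variance `v / (1 + a v)`. -/
lemma integral_mul_exp_gaussianReal {v : NNReal} (hv : v ≠ 0) (a : NNReal) (f : ℝ → ℝ) :
    ∫ x, f x * Real.exp (-(a * x ^ 2 / 2)) ∂(gaussianReal 0 v)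
      = (√(1 + a * v))⁻¹ * ∫ x, f x ∂(gaussianReal 0 (v / (1 + a * v))) := by
  have hv0 : (0:ℝ) < v := by exact_mod_cast pos_iff_ne_zero.2 hv
  have ha0 : (0:ℝ) ≤ a := a.2
  have hd : (0:ℝ) < 1 + a * v := by positivity
  have hw : v / (1 + a * v) ≠ 0 := by
    have : 0 < v / (1 + a * v) := by
      rw [← NNReal.coe_pos]; push_cast; positivity
    exact this.ne'
  rw [integral_gaussianReal_eq_integral_smul hv, integral_gaussianReal_eq_integral_smul hw,
    ← integral_const_mul]
  congr 1
  funext x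
  simp only [gaussianPDFReal, smul_eq_mul, sub_zero]
  push_cast
  have e1 : Real.exp (-x ^ 2 / (2 * (v / (1 + a * v))))
      = Real.exp (-x ^ 2 / (2 * v)) * Real.exp (-(a * x ^ 2 / 2)) := by
    rw [← Real.exp_add]; congr 1; field_simp; ring
  have e2 : √(2 * Real.pi * (v / (1 + a * v))) = √(2 * Real.pi * v) / √(1 + a * v) := by
    rw [← mul_div_assoc, Real.sqrt_div (by positivity)]
  rw [e1, e2]
  have : √(1 + a * v : ℝ) ≠ 0 := (Real.sqrt_pos.2 hd).ne'
  field_simp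

lemma integral_exp_gaussianReal {v : NNReal} (hv : v ≠ 0) (a : NNReal) :
    ∫ x, Real.exp (-(a * x ^ 2 / 2)) ∂(gaussianReal 0 v) = (√(1 + a * v))⁻¹ := by
  simpa using integral_mul_exp_gaussianReal hv a fun _ => 1

lemma integral_id_mul_exp_gaussianReal {v : NNReal} (hv : v ≠ 0) (a : NNReal) :
    ∫ x, x * Real.exp (-(a * x ^ 2 / 2)) ∂(gaussianReal 0 v) = 0 := by
  simpa using integral_mul_exp_gaussianReal hv a fun x => x

lemma integral_sq_mul_exp_gaussianReal {v : NNReal} (hv : v ≠ 0) (a : NNReal) :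
    ∫ x, x ^ 2 * Real.exp (-(a * x ^ 2 / 2)) ∂(gaussianReal 0 v)
      = v / (1 + a * v) * (√(1 + a * v))⁻¹ := by
  have h := variance_fun_id_gaussianReal (μ := 0) (v := v / (1 + a * v))
  rw [variance_eq_integral (by fun_prop)] at h
  simp only [integral_id_gaussianReal, sub_zero] at h
  rw [integral_mul_exp_gaussianReal hv a fun x => x ^ 2, h]
  push_cast
  ring

lemma integrableOn_mul_exp_neg_sq {S : ℝ} (hS : 0 < S) :
    IntegrableOn (fun u : ℝ => u * Real.exp (-(u ^ 2 * S / 2))) (Set.Ioi 0) := by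
  have := (integrable_mul_exp_neg_mul_sq (half_pos hS)).integrableOn (s := Set.Ioi 0)
  refine this.congr_fun (fun u _ => ?_) measurableSet_Ioi
  ring_nf

lemma integral_Ioi_mul_exp_neg_sq {S : ℝ} (hS : 0 < S) :
    ∫ u in Set.Ioi (0:ℝ), u * Real.exp (-(u ^ 2 * S / 2)) = S⁻¹ := by
  have h := integral_mul_cexp_neg_mul_sq (b := (S / 2 : ℝ)) (by simpa using hS)
  rw [← Complex.ofReal_inj, ← integral_complex_ofReal]
  convert! h using 1
  · refine setIntegral_congr_fun measurableSet_Ioi fun u _ => ?_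
    push_cast
    ring_nf
  · push_cast
    have : (S : ℂ) ≠ 0 := by exact_mod_cast hS.ne'
    field_simp

/-- The variance `1 / ((n + 1) π) ^ 2` of the `n`-th cosine coefficient of Brownian motion. -/
noncomputable def cosVar (n : ℕ) : NNReal := (1 / cosFreq n ^ 2).toNNReal

lemma coe_cosVar (n : ℕ) : (cosVar n : ℝ) = 1 / cosFreq n ^ 2 :=
  Real.coe_toNNReal _ (by positivity)

lemma cosVar_ne_zero (n : ℕ) : cosVar n ≠ 0 := by
  have := cosFreq_pos n
  rw [← NNReal.coe_ne_zero, coe_cosVar]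
  positivity

/-- The integrand `u ^ {3/2} / (√(sinh u) (((n + 1) π) ^ 2 + u ^ 2))`, whose integral over `(0, ∞)`
is the mean share of the `n`-th cosine coefficient in the total energy. -/
noncomputable def shareDensity (n : ℕ) (u : ℝ) : ℝ :=
  u * (√(u / Real.sinh u) * (1 / (cosFreq n ^ 2 + u ^ 2)))

lemma shareDensity_nonneg (n : ℕ) {u : ℝ} (hu : 0 < u) : 0 ≤ shareDensity n u := by
  unfold shareDensity; positivity

/-- `ξ` is a sequence of independent centered Gaussians with the variances of the cosine
coefficients of Brownian motion. -/
structure IsCosGaussian {Ω : Type*} [MeasurableSpace Ω] (P : Measure Ω) (ξ : ℕ → Ω → ℝ) :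
    Prop where
  measurable : ∀ n, Measurable (ξ n)
  indep : iIndepFun ξ P
  law : ∀ n, P.map (ξ n) = gaussianReal 0 (cosVar n)

lemma measurable_of_hasSum_sq {Ω : Type*} {m : MeasurableSpace Ω} {ξ : ℕ → Ω → ℝ} {S : Ω → ℝ}
    (hξ : ∀ n, Measurable (ξ n))
    (hS : ∀ ω, HasSum (fun n => ξ n ω ^ 2) (S ω)) : Measurable S :=
  measurable_of_tendsto_metrizable (f := fun N ω => ∑ n ∈ Finset.range N, ξ n ω ^ 2)
    (fun _ => Finset.measurable_sum _ fun n _ => (hξ n).pow_const 2)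
    (tendsto_pi_nhds.2 fun ω => (hS ω).tendsto_sum_nat)

section Gaussian

variable {Ω : Type*} [MeasurableSpace Ω] {P : Measure Ω} {ξ : ℕ → Ω → ℝ} {S : Ω → ℝ}

lemma IsCosGaussian.integral_prod (h : IsCosGaussian P ξ) (K : ℕ) {f : ℕ → ℝ → ℝ}
    (hf : ∀ k, Measurable (f k)) :
    ∫ ω, ∏ k ∈ Finset.range K, f k (ξ k ω) ∂P
      = ∏ k ∈ Finset.range K, ∫ x, f k x ∂(gaussianReal 0 (cosVar k)) := by
  have hi := h.indep.precomp (g := fun k : Fin K => (k : ℕ)) Fin.val_injective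
  have := hi.integral_fun_prod_comp (f := fun k : Fin K => f k)
    (fun k => (h.measurable k).aemeasurable) (fun k => (hf k).aestronglyMeasurable)
  simp only [Finset.prod_range]
  rw [this]
  refine Finset.prod_congr rfl fun k _ => ?_
  rw [← h.law, integral_map (h.measurable k).aemeasurable (hf k).aestronglyMeasurable]

lemma IsCosGaussian.memLp_two (h : IsCosGaussian P ξ) (n : ℕ) : MemLp (ξ n) 2 P := by
  have := memLp_id_gaussianReal (μ := 0) (v := cosVar n) 2
  rw [← h.law] at this
  exact (memLp_map_measure_iff (by fun_prop) (h.measurable n).aemeasurable).1 this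

lemma IsCosGaussian.tendsto_integral_mul_mul_exp [IsProbabilityMeasure P] (h : IsCosGaussian P ξ)
    (hS : ∀ ω, HasSum (fun n => ξ n ω ^ 2) (S ω)) (i j : ℕ) (u : ℝ) :
    Tendsto (fun K => ∫ ω, ξ i ω * ξ j ω *
        Real.exp (-(u ^ 2 * (∑ k ∈ Finset.range K, ξ k ω ^ 2) / 2)) ∂P) atTop
      (𝓝 (∫ ω, ξ i ω * ξ j ω * Real.exp (-(u ^ 2 * S ω / 2)) ∂P)) := by
  have hm := h.measurable
  refine tendsto_integral_of_dominated_convergence (fun ω => ‖ξ i ω * ξ j ω‖)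
    (fun K => ?_) ?_ (fun K => ae_of_all _ fun ω => ?_) (ae_of_all _ fun ω => ?_)
  · exact Measurable.aestronglyMeasurable (by fun_prop)
  · exact ((h.memLp_two i).integrable_mul (h.memLp_two j)).norm
  · rw [norm_mul]
    refine mul_le_of_le_one_right (norm_nonneg _) ?_
    rw [Real.norm_eq_abs, Real.abs_exp, Real.exp_le_one_iff, neg_nonpos]
    have : 0 ≤ ∑ k ∈ Finset.range K, ξ k ω ^ 2 := Finset.sum_nonneg fun k _ => sq_nonneg _
    positivity
  · have := (hS ω).tendsto_sum_nat
    refine Tendsto.const_mul _ (Real.continuous_exp.tendsto _ |>.comp ?_)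
    exact ((this.const_mul _).div_const 2).neg

lemma IsCosGaussian.integral_mul_mul_exp_partial (h : IsCosGaussian P ξ) {i j K : ℕ} (hi : i < K)
    (hj : j < K) (u : ℝ) :
    ∫ ω, ξ i ω * ξ j ω * Real.exp (-(u ^ 2 * (∑ k ∈ Finset.range K, ξ k ω ^ 2) / 2)) ∂P
      = if i = j then 1 / (cosFreq i ^ 2 + u ^ 2) *
          √((∏ k ∈ Finset.range K, (1 + u ^ 2 / cosFreq k ^ 2))⁻¹) else 0 := by
  set f : ℕ → ℝ → ℝ := fun k x =>
    (if k = i then x else 1) * (if k = j then x else 1) * Real.exp (-(u ^ 2 * x ^ 2 / 2)) with hfdef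
  have hf : ∀ k, Measurable (f k) := by
    intro k
    simp only [hfdef]
    split_ifs <;> fun_prop
  have hprod (ω : Ω) : ξ i ω * ξ j ω *
      Real.exp (-(u ^ 2 * (∑ k ∈ Finset.range K, ξ k ω ^ 2) / 2))
      = ∏ k ∈ Finset.range K, f k (ξ k ω) := by
    simp only [hfdef, Finset.prod_mul_distrib]
    rw [Finset.prod_ite_eq' _ i, Finset.prod_ite_eq' _ j, ← Real.exp_sum,
      if_pos (Finset.mem_range.2 hi), if_pos (Finset.mem_range.2 hj)]
    congr 2
    rw [Finset.mul_sum, Finset.sum_div, Finset.sum_neg_distrib]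
  simp_rw [hprod]
  rw [h.integral_prod K hf]
  have ha : ((u ^ 2).toNNReal : ℝ) = u ^ 2 := Real.coe_toNNReal _ (sq_nonneg u)
  split_ifs with hij
  · subst hij
    have hfac (k : ℕ) : ∫ x, f k x ∂(gaussianReal 0 (cosVar k))
        = (if k = i then 1 / (cosFreq i ^ 2 + u ^ 2) else 1) *
          (√(1 + u ^ 2 / cosFreq k ^ 2))⁻¹ := by
      have hpos := cosFreq_pos k
      by_cases hk : k = i
      · subst hk
        have := integral_sq_mul_exp_gaussianReal (cosVar_ne_zero k) (u ^ 2).toNNReal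
        rw [ha, coe_cosVar] at this
        simp only [hfdef, if_true, ← sq]
        rw [this]
        congr 1
        · field_simp
        · rw [mul_one_div]
      · have := integral_exp_gaussianReal (cosVar_ne_zero k) (u ^ 2).toNNReal
        rw [ha, coe_cosVar] at this
        simp only [hfdef, if_neg hk, one_mul]
        rw [this, mul_one_div]
    simp_rw [hfac]
    rw [Finset.prod_mul_distrib, Finset.prod_ite_eq' _ i, if_pos (Finset.mem_range.2 hi),
      Real.sqrt_inv, Real.sqrt_prod _ fun k _ => by positivity, Finset.prod_inv_distrib]
  · refine Finset.prod_eq_zero (Finset.mem_range.2 hi) ?_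
    have := integral_id_mul_exp_gaussianReal (cosVar_ne_zero i) (u ^ 2).toNNReal
    rw [ha] at this
    simpa only [hfdef, if_true, if_neg hij, mul_one] using this

lemma IsCosGaussian.integral_mul_mul_exp [IsProbabilityMeasure P] (h : IsCosGaussian P ξ)
    (hS : ∀ ω, HasSum (fun n => ξ n ω ^ 2) (S ω)) (i j : ℕ) {u : ℝ} (hu : 0 < u) :
    ∫ ω, ξ i ω * ξ j ω * Real.exp (-(u ^ 2 * S ω / 2)) ∂P
      = if i = j then 1 / (cosFreq i ^ 2 + u ^ 2) * √(u / Real.sinh u) else 0 := by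
  refine tendsto_nhds_unique (h.tendsto_integral_mul_mul_exp hS i j u) ?_
  have hlim : Tendsto (fun K : ℕ => if i = j then 1 / (cosFreq i ^ 2 + u ^ 2) *
      √((∏ k ∈ Finset.range K, (1 + u ^ 2 / cosFreq k ^ 2))⁻¹) else 0) atTop
      (𝓝 (if i = j then 1 / (cosFreq i ^ 2 + u ^ 2) * √(u / Real.sinh u) else 0)) := by
    split_ifs
    · refine Tendsto.const_mul _ (Real.continuous_sqrt.tendsto _ |>.comp ?_)
      have hs := Real.sinh_pos_iff.2 hu
      have := (tendsto_prod_one_add_sq_div_cosFreq_sq hu).inv₀ (by positivity)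
      rwa [inv_div] at this
    · exact tendsto_const_nhds
  refine hlim.congr' ?_
  filter_upwards [eventually_gt_atTop i, eventually_gt_atTop j] with K hi hj
  exact (h.integral_mul_mul_exp_partial hi hj u).symm

lemma abs_mul_le_of_hasSum_sq {x : ℕ → ℝ} {s : ℝ} (hs : HasSum (fun n => x n ^ 2) s) (i j : ℕ) :
    |x i * x j| ≤ s := by
  have h1 := le_hasSum hs i fun _ _ => sq_nonneg _
  have h2 := le_hasSum hs j fun _ _ => sq_nonneg _
  rw [abs_le]
  constructor <;> nlinarith [sq_nonneg (x i + x j), sq_nonneg (x i - x j)]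

lemma abs_mul_div_le_one {x : ℕ → ℝ} {s : ℝ} (hs : HasSum (fun n => x n ^ 2) s) (i j : ℕ) :
    |x i * x j / s| ≤ 1 := by
  have h := abs_mul_le_of_hasSum_sq hs i j
  rw [abs_div, abs_of_nonneg ((abs_nonneg _).trans h)]
  exact div_le_one_of_le₀ h ((abs_nonneg _).trans h)

lemma integrableOn_mul_mul_exp {x : ℕ → ℝ} {s : ℝ} (hs : HasSum (fun n => x n ^ 2) s) (i j : ℕ) :
    IntegrableOn (fun u : ℝ => u * (x i * x j * Real.exp (-(u ^ 2 * s / 2)))) (Set.Ioi 0) := by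
  have h := abs_mul_le_of_hasSum_sq hs i j
  rcases ((abs_nonneg _).trans h).eq_or_lt with h0 | h0
  · rw [← h0] at h
    simp [abs_eq_zero.1 (le_antisymm h (abs_nonneg _))]
  · exact IntegrableOn.congr_fun ((integrableOn_mul_exp_neg_sq h0).const_mul (x i * x j))
      (fun u _ => by ring) measurableSet_Ioi

lemma integral_mul_mul_exp_eq_div {x : ℕ → ℝ} {s : ℝ} (hs : HasSum (fun n => x n ^ 2) s)
    (i j : ℕ) :
    ∫ u in Set.Ioi (0:ℝ), u * (x i * x j * Real.exp (-(u ^ 2 * s / 2))) = x i * x j / s := by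
  have h := abs_mul_le_of_hasSum_sq hs i j
  rcases ((abs_nonneg _).trans h).eq_or_lt with h0 | h0
  · rw [← h0] at h
    simp [abs_eq_zero.1 (le_antisymm h (abs_nonneg _))]
  · rw [div_eq_mul_inv, ← integral_Ioi_mul_exp_neg_sq h0, ← integral_const_mul]
    congr 1
    funext u
    ring

lemma IsCosGaussian.integrable_prod [IsProbabilityMeasure P] (h : IsCosGaussian P ξ)
    (hS : ∀ ω, HasSum (fun n => ξ n ω ^ 2) (S ω)) (i j : ℕ) :
    Integrable (fun p : Ω × ℝ => p.2 * (ξ i p.1 * ξ j p.1 * Real.exp (-(p.2 ^ 2 * S p.1 / 2))))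
      (P.prod (volume.restrict (Set.Ioi 0))) := by
  have hm := h.measurable
  have hSm := measurable_of_hasSum_sq hm hS
  rw [integrable_prod_iff (Measurable.aestronglyMeasurable (by fun_prop))]
  refine ⟨ae_of_all _ fun ω => integrableOn_mul_mul_exp (hS ω) i j, ?_⟩
  have e (ω : Ω) : ∫ u in Set.Ioi (0:ℝ), ‖u * (ξ i ω * ξ j ω * Real.exp (-(u ^ 2 * S ω / 2)))‖
      = |ξ i ω * ξ j ω / S ω| := by
    have hS0 : 0 ≤ S ω := (abs_nonneg _).trans (abs_mul_le_of_hasSum_sq (hS ω) i j)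
    have hx := integral_mul_mul_exp_eq_div (x := fun n => |ξ n ω|) (by simpa using hS ω) i j
    rw [abs_div, abs_mul, abs_of_nonneg hS0, ← hx]
    refine setIntegral_congr_fun measurableSet_Ioi fun u hu => ?_
    simp only [norm_mul, Real.norm_eq_abs, Real.abs_exp, abs_of_pos (Set.mem_Ioi.1 hu)]
  simp only [e]
  refine Integrable.of_bound (Measurable.aestronglyMeasurable (by fun_prop)) 1
    (ae_of_all _ fun ω => ?_)
  simpa using abs_mul_div_le_one (hS ω) i j

lemma IsCosGaussian.integral_mul_div [IsProbabilityMeasure P] (h : IsCosGaussian P ξ)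
    (hS : ∀ ω, HasSum (fun n => ξ n ω ^ 2) (S ω)) (i j : ℕ) :
    ∫ ω, ξ i ω * ξ j ω / S ω ∂P
      = if i = j then ∫ u in Set.Ioi (0:ℝ), shareDensity i u else 0 := by
  simp_rw [← integral_mul_mul_exp_eq_div (hS _) i j]
  rw [integral_integral_swap (h.integrable_prod hS i j)]
  have e : ∫ u in Set.Ioi (0:ℝ), ∫ ω, u * (ξ i ω * ξ j ω * Real.exp (-(u ^ 2 * S ω / 2))) ∂P
      = ∫ u in Set.Ioi (0:ℝ), if i = j then shareDensity i u else 0 := by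
    refine setIntegral_congr_fun measurableSet_Ioi fun u hu => ?_
    rw [integral_const_mul, h.integral_mul_mul_exp hS i j hu]
    split_ifs
    · unfold shareDensity; ring
    · simp
  rw [e]
  split_ifs <;> simp

lemma IsCosGaussian.integrableOn_shareDensity [IsProbabilityMeasure P] (h : IsCosGaussian P ξ)
    (hS : ∀ ω, HasSum (fun n => ξ n ω ^ 2) (S ω)) (i : ℕ) :
    IntegrableOn (shareDensity i) (Set.Ioi 0) := by
  refine (h.integrable_prod hS i i).integral_prod_right.congr ?_
  filter_upwards [ae_restrict_mem measurableSet_Ioi] with u hu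
  rw [integral_const_mul, h.integral_mul_mul_exp hS i i hu, if_pos rfl]
  unfold shareDensity
  ring

end Gaussian

/-- The second moment of the correlation coefficient of two independent Gaussian sequences. -/
lemma hasSum_sq_integral_shareDensity {Ω : Type*} {m₁ m₂ : MeasurableSpace Ω} [MeasurableSpace Ω]
    {P : Measure Ω} [IsProbabilityMeasure P] {ξ η : ℕ → Ω → ℝ} {S T Z : Ω → ℝ}
    (hξ : IsCosGaussian P ξ) (hη : IsCosGaussian P η)
    (hS : ∀ ω, HasSum (fun n => ξ n ω ^ 2) (S ω)) (hT : ∀ ω, HasSum (fun n => η n ω ^ 2) (T ω))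
    (hZ : ∀ ω, HasSum (fun n => ξ n ω * η n ω) (Z ω))
    (hm : Indep m₁ m₂ P) (hm₁ : ∀ n, Measurable[m₁] (ξ n)) (hm₂ : ∀ n, Measurable[m₂] (η n)) :
    HasSum (fun n => (∫ u in Set.Ioi (0:ℝ), shareDensity n u) ^ 2)
      (∫ ω, Z ω ^ 2 / (S ω * T ω) ∂P) := by
  have hξm := hξ.measurable
  have hηm := hη.measurable
  have hSm := measurable_of_hasSum_sq hξm hS
  have hTm := measurable_of_hasSum_sq hηm hT
  have hS0 (ω) : 0 ≤ S ω := (hS ω).nonneg fun _ => sq_nonneg _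
  have hT0 (ω) : 0 ≤ T ω := (hT ω).nonneg fun _ => sq_nonneg _
  have hind (i j : ℕ) : IndepFun (fun ω => ξ i ω * ξ j ω / S ω) (fun ω => η i ω * η j ω / T ω) P := by
    have h₁ : Measurable[m₁] fun ω => ξ i ω * ξ j ω / S ω :=
      ((hm₁ i).mul (hm₁ j)).div (measurable_of_hasSum_sq hm₁ hS)
    have h₂ : Measurable[m₂] fun ω => η i ω * η j ω / T ω :=
      ((hm₂ i).mul (hm₂ j)).div (measurable_of_hasSum_sq hm₂ hT)
    rw [IndepFun_iff_Indep]
    exact indep_of_indep_of_le_left (indep_of_indep_of_le_right hm h₂.comap_le) h₁.comap_le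
  rw [hasSum_iff_tendsto_nat_of_nonneg fun _ => sq_nonneg _]
  have hInt (i j : ℕ) : Integrable (fun ω => ξ i ω * ξ j ω / S ω * (η i ω * η j ω / T ω)) P := by
    refine Integrable.of_bound (Measurable.aestronglyMeasurable (by fun_prop)) 1
      (ae_of_all _ fun ω => ?_)
    rw [norm_mul]
    exact mul_le_one₀ (abs_mul_div_le_one (hS ω) i j) (norm_nonneg _)
      (abs_mul_div_le_one (hT ω) i j)
  have hlim : Tendsto (fun N => ∫ ω, (∑ n ∈ Finset.range N, ξ n ω * η n ω) ^ 2 / (S ω * T ω) ∂P)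
      atTop (𝓝 (∫ ω, Z ω ^ 2 / (S ω * T ω) ∂P)) := by
    refine tendsto_integral_of_dominated_convergence (fun _ => 1) (fun N => ?_)
      (integrable_const _) (fun N => ae_of_all _ fun ω => ?_) (ae_of_all _ fun ω => ?_)
    · exact Measurable.aestronglyMeasurable (by fun_prop)
    · have hST := mul_nonneg (hS0 ω) (hT0 ω)
      rw [Real.norm_of_nonneg (div_nonneg (sq_nonneg _) hST)]
      refine div_le_one_of_le₀ ((Finset.sum_mul_sq_le_sq_mul_sq _ _ _).trans ?_) hST
      exact mul_le_mul (sum_le_hasSum _ (fun _ _ => sq_nonneg _) (hS ω))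
        (sum_le_hasSum _ (fun _ _ => sq_nonneg _) (hT ω))
        (Finset.sum_nonneg fun _ _ => sq_nonneg _) (hS0 ω)
    · exact ((hZ ω).tendsto_sum_nat.pow 2).div_const _
  refine hlim.congr fun N => ?_
  have hexp (ω : Ω) : (∑ n ∈ Finset.range N, ξ n ω * η n ω) ^ 2 / (S ω * T ω)
      = ∑ i ∈ Finset.range N, ∑ j ∈ Finset.range N,
        ξ i ω * ξ j ω / S ω * (η i ω * η j ω / T ω) := by
    rw [sq, Finset.sum_mul_sum, Finset.sum_div]
    refine Finset.sum_congr rfl fun i _ => ?_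
    rw [Finset.sum_div]
    refine Finset.sum_congr rfl fun j _ => ?_
    rw [div_mul_div_comm]
    ring
  simp_rw [hexp]
  rw [integral_finsetSum _ fun i _ => integrable_finsetSum _ fun j _ => hInt i j]
  refine Finset.sum_congr rfl fun i hi => ?_
  rw [integral_finsetSum _ fun j _ => hInt i j]
  have hterm (j : ℕ) : ∫ ω, ξ i ω * ξ j ω / S ω * (η i ω * η j ω / T ω) ∂P
      = if i = j then (∫ u in Set.Ioi (0:ℝ), shareDensity i u) ^ 2 else 0 := by
    rw [(hind i j).integral_fun_mul_eq_mul_integral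
      (Measurable.aestronglyMeasurable (by fun_prop))
      (Measurable.aestronglyMeasurable (by fun_prop)), hξ.integral_mul_div hS,
      hη.integral_mul_div hT]
    split_ifs <;> ring
  simp_rw [hterm]
  rw [Finset.sum_ite_eq, if_pos hi]

lemma integrable_and_hasSum_integral_of_nonneg {α : Type*} [MeasurableSpace α] {μ : Measure α}
    {F : ℕ → α → ℝ} {H : α → ℝ} (hF : ∀ n, Integrable (F n) μ) (h0 : ∀ n, 0 ≤ᵐ[μ] F n)
    (hsum : Summable fun n => ∫ a, F n a ∂μ) (hH : ∀ᵐ a ∂μ, HasSum (fun n => F n a) (H a)) :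
    Integrable H μ ∧ HasSum (fun n => ∫ a, F n a ∂μ) (∫ a, H a ∂μ) := by
  have hnorm (n : ℕ) : ∫ a, ‖F n a‖ ∂μ = ∫ a, F n a ∂μ :=
    integral_congr_ae ((h0 n).mono fun a ha => Real.norm_of_nonneg ha)
  constructor
  · refine ⟨aestronglyMeasurable_of_tendsto_ae atTop
      (f := fun N a => ∑ n ∈ Finset.range N, F n a)
      (fun N => (integrable_finsetSum _ fun n _ => hF n).1)
      (hH.mono fun a ha => ha.tendsto_sum_nat), ?_⟩
    have e : ∫⁻ a, ‖H a‖ₑ ∂μ = ∑' n, ENNReal.ofReal (∫ a, F n a ∂μ) := by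
      have e1 : ∫⁻ a, ‖H a‖ₑ ∂μ = ∫⁻ a, ∑' n, ENNReal.ofReal (F n a) ∂μ := by
        refine lintegral_congr_ae ?_
        filter_upwards [hH, ae_all_iff.2 h0] with a ha ha0
        rw [Real.enorm_of_nonneg (ha.nonneg ha0), ← ha.tsum_eq,
          ENNReal.ofReal_tsum_of_nonneg ha0 ha.summable]
      rw [e1, lintegral_tsum fun n => (hF n).aemeasurable.ennreal_ofReal]
      refine tsum_congr fun n => ?_
      rw [ofReal_integral_eq_lintegral_ofReal (hF n) (h0 n)]
    rw [HasFiniteIntegral, e, ← ENNReal.ofReal_tsum_of_nonneg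
      (fun n => integral_nonneg_of_ae (h0 n)) hsum]
    exact ENNReal.ofReal_lt_top
  · have h := hasSum_integral_of_summable_integral_norm hF (by simpa only [hnorm] using hsum)
    rwa [integral_congr_ae (hH.mono fun a ha => ha.tsum_eq)] at h

lemma ae_prod_restrict_Ioi :
    ∀ᵐ p ∂((volume.restrict (Set.Ioi (0:ℝ))).prod (volume.restrict (Set.Ioi (0:ℝ)))),
      0 < p.1 ∧ 0 < p.2 ∧ p.1 ≠ p.2 := by
  have hs : MeasurableSet {p : ℝ × ℝ | 0 < p.1 ∧ 0 < p.2 ∧ p.1 ≠ p.2} :=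
    (measurableSet_lt measurable_const measurable_fst).inter
      ((measurableSet_lt measurable_const measurable_snd).inter
        (measurableSet_eq_fun measurable_fst measurable_snd).compl)
  rw [Measure.ae_prod_iff_ae_ae hs]
  filter_upwards [ae_restrict_mem measurableSet_Ioi] with x hx
  filter_upwards [ae_restrict_mem measurableSet_Ioi,
    ae_restrict_of_ae (Measure.ae_ne volume x)] with y hy hxy
  exact ⟨hx, hy, hxy.symm⟩

/-- The integral over the quadrant of a symmetric function is twice that over a half of it. -/
lemma integral_quadrant_eq_two_mul {H : ℝ × ℝ → ℝ}
    (hH : Integrable H ((volume.restrict (Set.Ioi (0:ℝ))).prod (volume.restrict (Set.Ioi (0:ℝ)))))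
    (hsymm : ∀ p, H p.swap = H p) :
    ∫ p, H p ∂((volume.restrict (Set.Ioi (0:ℝ))).prod (volume.restrict (Set.Ioi (0:ℝ))))
      = ∫ v in Set.Ioi (0:ℝ), ∫ u in (0:ℝ)..v, 2 * H (u, v) := by
  set μ : Measure ℝ := volume.restrict (Set.Ioi (0:ℝ)) with hμ
  set A : Set (ℝ × ℝ) := {p | p.1 < p.2} with hA
  set B : Set (ℝ × ℝ) := {p | p.2 < p.1} with hB
  have hAm : MeasurableSet A := measurableSet_lt measurable_fst measurable_snd
  have hBm : MeasurableSet B := measurableSet_lt measurable_snd measurable_fst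
  have hsplit : ∫ p, H p ∂(μ.prod μ)
      = ∫ p, A.indicator H p ∂(μ.prod μ) + ∫ p, B.indicator H p ∂(μ.prod μ) := by
    rw [← integral_add (hH.indicator hAm) (hH.indicator hBm)]
    refine integral_congr_ae ?_
    filter_upwards [ae_prod_restrict_Ioi] with p hp
    rcases lt_or_gt_of_ne hp.2.2 with h | h
    · simp [hA, hB, h, h.not_gt]
    · simp [hA, hB, h, h.not_gt]
  have hswap : ∫ p, B.indicator H p ∂(μ.prod μ) = ∫ p, A.indicator H p ∂(μ.prod μ) := by
    rw [← integral_prod_swap]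
    refine integral_congr_ae (ae_of_all _ fun p => ?_)
    simp only [Set.indicator, hA, hB, Set.mem_ofPred_eq, Prod.fst_swap, Prod.snd_swap, hsymm]
  rw [hsplit, hswap, ← two_mul, integral_prod_symm _ (hH.indicator hAm), ← integral_const_mul]
  refine setIntegral_congr_fun measurableSet_Ioi fun v hv => ?_
  have hv0 : (0:ℝ) ≤ v := (Set.mem_Ioi.1 hv).le
  rw [intervalIntegral.integral_const_mul, intervalIntegral.integral_of_le hv0,
    integral_Ioc_eq_integral_Ioo, ← Set.Ioi_inter_Iio, Set.inter_comm,
    ← Measure.restrict_restrict measurableSet_Iio, ← integral_indicator measurableSet_Iio]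
  rfl

lemma hasSum_shareDensity_mul {u v : ℝ} (hu : 0 < u) (hv : 0 < v) (huv : u ≠ v) :
    HasSum (fun n => shareDensity n u * shareDensity n v)
      ((u * √(u / Real.sinh u)) * (v * √(v / Real.sinh v)) *
        ((1 / (u * Real.tanh u) - 1 / (v * Real.tanh v) - 1 / u ^ 2 + 1 / v ^ 2)
          / (2 * (v ^ 2 - u ^ 2)))) := by
  refine ((hasSum_inv_mul_inv hu hv huv).mul_left _).congr_fun fun n => ?_
  unfold shareDensity
  ring

lemma integral_triangle_of_hasSum {c : ℝ} (hInt : ∀ n, IntegrableOn (shareDensity n) (Set.Ioi 0))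
    (hc : HasSum (fun n => (∫ u in Set.Ioi (0:ℝ), shareDensity n u) ^ 2) c) :
    c = ∫ v in Set.Ioi (0:ℝ), ∫ u in (0:ℝ)..v,
          (u * v * Real.sqrt (u * v) /
              ((v ^ 2 - u ^ 2) * Real.sqrt (Real.sinh u * Real.sinh v))) *
            (1 / (u * Real.tanh u) - 1 / (v * Real.tanh v) - 1 / u ^ 2 + 1 / v ^ 2) := by
  set H : ℝ × ℝ → ℝ := fun p =>
    (p.1 * √(p.1 / Real.sinh p.1)) * (p.2 * √(p.2 / Real.sinh p.2)) *
        ((1 / (p.1 * Real.tanh p.1) - 1 / (p.2 * Real.tanh p.2) - 1 / p.1 ^ 2 + 1 / p.2 ^ 2)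
          / (2 * (p.2 ^ 2 - p.1 ^ 2))) with hHdef
  have hmul (n : ℕ) : ∫ p, shareDensity n p.1 * shareDensity n p.2
      ∂((volume.restrict (Set.Ioi (0:ℝ))).prod (volume.restrict (Set.Ioi (0:ℝ))))
      = (∫ u in Set.Ioi (0:ℝ), shareDensity n u) ^ 2 := by
    rw [integral_prod_mul, sq]
  have hF (n : ℕ) : Integrable (fun p : ℝ × ℝ => shareDensity n p.1 * shareDensity n p.2)
      ((volume.restrict (Set.Ioi (0:ℝ))).prod (volume.restrict (Set.Ioi (0:ℝ)))) :=
    Integrable.mul_prod (hInt n) (hInt n)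
  have hF0 (n : ℕ) : 0 ≤ᵐ[(volume.restrict (Set.Ioi (0:ℝ))).prod (volume.restrict (Set.Ioi (0:ℝ)))]
      fun p : ℝ × ℝ => shareDensity n p.1 * shareDensity n p.2 := by
    filter_upwards [ae_prod_restrict_Ioi] with p hp
    exact mul_nonneg (shareDensity_nonneg n hp.1) (shareDensity_nonneg n hp.2.1)
  have hFH : ∀ᵐ p ∂((volume.restrict (Set.Ioi (0:ℝ))).prod (volume.restrict (Set.Ioi (0:ℝ)))),
      HasSum (fun n => shareDensity n p.1 * shareDensity n p.2) (H p) := by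
    filter_upwards [ae_prod_restrict_Ioi] with p hp
    exact hasSum_shareDensity_mul hp.1 hp.2.1 hp.2.2
  obtain ⟨hHint, hHsum⟩ := integrable_and_hasSum_integral_of_nonneg hF hF0
    (by simpa only [hmul] using hc.summable) hFH
  simp only [hmul] at hHsum
  rw [hc.unique hHsum, integral_quadrant_eq_two_mul hHint]
  · refine setIntegral_congr_fun measurableSet_Ioi fun v hv => ?_
    have hv0 : 0 < v := hv
    refine intervalIntegral.integral_congr_ae ?_
    rw [Set.uIoc_of_le hv0.le]
    refine ae_of_all _ fun u hu => ?_
    have hu0 : 0 < u := hu.1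
    have hsu := (Real.sinh_pos_iff.2 hu0).le
    have hsv := (Real.sinh_pos_iff.2 hv0).le
    simp only [hHdef]
    rw [Real.sqrt_div hu0.le, Real.sqrt_div hv0.le, Real.sqrt_mul hu0.le, Real.sqrt_mul hsu,
      mul_comm (2:ℝ) (v ^ 2 - u ^ 2)]
    simp only [div_eq_mul_inv, mul_inv]
    ring
  · rintro ⟨u, v⟩
    simp only [hHdef, Prod.swap_prod_mk]
    rw [← neg_sub (v ^ 2) (u ^ 2), mul_neg, div_neg, ← neg_div]
    ring

/-- The left Riemann sum of `h` for the partition of the unit interval into `N` equal parts. -/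
noncomputable def riemannSum (N : ℕ) (h : ℝ → ℝ) : ℝ := ∑ k : Fin N, (N : ℝ)⁻¹ * h (k / N)

lemma abs_riemannSum_sub_integral_le {h : ℝ → ℝ} (hh : Continuous h) {N : ℕ} (hN : N ≠ 0) {ε : ℝ}
    (hε : ∀ x ∈ Set.Icc (0:ℝ) 1, ∀ y ∈ Set.Icc (0:ℝ) 1, |x - y| ≤ (N : ℝ)⁻¹ → |h x - h y| ≤ ε) :
    |riemannSum N h - ∫ t in (0:ℝ)..1, h t| ≤ ε := by
  have hN0 : (0:ℝ) < N := by positivity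
  have hsplit : ∫ t in (0:ℝ)..1, h t
      = ∑ k ∈ Finset.range N, ∫ t in ((k:ℕ) / N : ℝ)..((k + 1 : ℕ) / N : ℝ), h t := by
    rw [intervalIntegral.sum_integral_adjacent_intervals (a := fun k : ℕ => (k / N : ℝ))
      fun k _ => hh.intervalIntegrable _ _]
    simp [hN0.ne']
  have hterm (k : ℕ) (hk : k ∈ Finset.range N) :
      |(N : ℝ)⁻¹ * h (k / N) - ∫ t in ((k:ℕ) / N : ℝ)..((k + 1 : ℕ) / N : ℝ), h t|
        ≤ ε * (N : ℝ)⁻¹ := by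
    have hlen : ((k + 1 : ℕ) / N : ℝ) - (k:ℕ) / N = (N : ℝ)⁻¹ := by
      push_cast; field_simp; ring
    have hle : ((k:ℕ) / N : ℝ) ≤ ((k + 1 : ℕ) / N : ℝ) := by
      rw [← sub_nonneg, hlen]; positivity
    have hk1 : ((k + 1 : ℕ) / N : ℝ) ≤ 1 := by
      rw [div_le_one hN0]; exact_mod_cast Finset.mem_range.1 hk
    have hk0 : (0:ℝ) ≤ (k:ℕ) / N := by positivity
    have e : (N : ℝ)⁻¹ * h (k / N) - ∫ t in ((k:ℕ) / N : ℝ)..((k + 1 : ℕ) / N : ℝ), h t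
        = ∫ t in ((k:ℕ) / N : ℝ)..((k + 1 : ℕ) / N : ℝ), (h (k / N) - h t) := by
      rw [intervalIntegral.integral_sub (by simp) (hh.intervalIntegrable _ _),
        intervalIntegral.integral_const, hlen, smul_eq_mul]
    rw [e, ← Real.norm_eq_abs]
    refine (intervalIntegral.norm_integral_le_of_norm_le_const (C := ε) fun t ht => ?_).trans_eq ?_
    · rw [Set.uIoc_of_le hle] at ht
      refine hε _ ⟨hk0, hle.trans hk1⟩ _ ⟨hk0.trans ht.1.le, ht.2.trans hk1⟩ ?_
      rw [abs_sub_comm, abs_of_nonneg (sub_nonneg.2 ht.1.le), ← hlen]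
      exact sub_le_sub_right ht.2 _
    · rw [hlen, abs_of_pos (inv_pos.2 hN0)]
  rw [riemannSum, Fin.sum_univ_eq_sum_range (fun k : ℕ => (N : ℝ)⁻¹ * h (k / N)), hsplit,
    ← Finset.sum_sub_distrib]
  refine (Finset.abs_sum_le_sum_abs _ _).trans ((Finset.sum_le_sum hterm).trans_eq ?_)
  rw [Finset.sum_const, Finset.card_range, nsmul_eq_mul]
  field_simp

lemma eventually_abs_riemannSum_sub_integral_le {F : ℝ → ℝ → ℝ}
    (hF : Continuous (Function.uncurry F)) {ε : ℝ} (hε : 0 < ε) :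
    ∀ᶠ N : ℕ in atTop, ∀ s ∈ Set.Icc (0:ℝ) 1,
      |riemannSum N (F s) - ∫ t in (0:ℝ)..1, F s t| ≤ ε := by
  have huc := (isCompact_Icc (a := (0:ℝ)) (b := 1)).prod (isCompact_Icc (a := (0:ℝ)) (b := 1))
    |>.uniformContinuousOn_of_continuous hF.continuousOn
  obtain ⟨δ, hδ, h⟩ := Metric.uniformContinuousOn_iff.1 huc ε hε
  filter_upwards [tendsto_inv_atTop_nhds_zero_nat.eventually_lt_const hδ, eventually_ne_atTop 0]
    with N hN hN0 s hs
  refine abs_riemannSum_sub_integral_le (by fun_prop) hN0 fun x hx y hy hxy => ?_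
  refine (h (s, x) ⟨hs, hx⟩ (s, y) ⟨hs, hy⟩ ?_).le
  rw [Prod.dist_eq, dist_self, max_eq_right dist_nonneg]
  exact hxy.trans_lt hN

lemma tendsto_riemannSum {h : ℝ → ℝ} (hh : Continuous h) :
    Tendsto (fun N => riemannSum N h) atTop (𝓝 (∫ t in (0:ℝ)..1, h t)) := by
  refine Metric.tendsto_nhds.2 fun ε hε => ?_
  filter_upwards [eventually_abs_riemannSum_sub_integral_le (F := fun _ => h)
    (hh.comp continuous_snd) (half_pos hε)] with N hN
  exact (hN 0 ⟨le_rfl, zero_le_one⟩).trans_lt (half_lt_self hε)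

lemma tendsto_riemannSum_riemannSum {F : ℝ → ℝ → ℝ} (hF : Continuous (Function.uncurry F)) :
    Tendsto (fun N => riemannSum N fun s => riemannSum N (F s)) atTop
      (𝓝 (∫ s in (0:ℝ)..1, ∫ t in (0:ℝ)..1, F s t)) := by
  have hG : Continuous fun s => ∫ t in (0:ℝ)..1, F s t :=
    intervalIntegral.continuous_parametric_intervalIntegral_of_continuous' hF 0 1
  refine Metric.tendsto_nhds.2 fun ε hε => ?_
  filter_upwards [eventually_abs_riemannSum_sub_integral_le hF (half_pos hε),
    Metric.tendsto_nhds.1 (tendsto_riemannSum hG) _ (half_pos hε), eventually_ne_atTop 0]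
    with N hN hN' hN0
  have hN1 : (0:ℝ) < N := by positivity
  have h1 : |(riemannSum N fun s => riemannSum N (F s))
      - riemannSum N fun s => ∫ t in (0:ℝ)..1, F s t| ≤ ε / 2 := by
    rw [riemannSum, riemannSum, ← Finset.sum_sub_distrib]
    simp_rw [← mul_sub]
    refine (Finset.abs_sum_le_sum_abs _ _).trans
      ((Finset.sum_le_sum (g := fun _ => (N : ℝ)⁻¹ * (ε / 2)) fun k _ => ?_).trans_eq ?_)
    · rw [abs_mul, abs_of_pos (inv_pos.2 hN1)]
      refine mul_le_mul_of_nonneg_left (hN _ ⟨by positivity, ?_⟩) (inv_pos.2 hN1).le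
      rw [div_le_one hN1]
      exact_mod_cast k.2.le
    · rw [Finset.sum_const, Finset.card_univ, Fintype.card_fin, nsmul_eq_mul]
      field_simp
  rw [Real.dist_eq] at hN' ⊢
  calc _ ≤ _ := abs_sub_le _ (riemannSum N fun s => ∫ t in (0:ℝ)..1, F s t) _
    _ < ε := by linarith

/-- The path of `W` on the half line, extended to a continuous path on the real line. -/
def extendPath {Ω : Type*} (W : ℝ → Ω → ℝ) (ω : Ω) (t : ℝ) : ℝ := W (max t 0) ω

lemma measurable_integral_mul_extendPath {Ω : Type*} [MeasurableSpace Ω] {W : ℝ → Ω → ℝ}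
    (hW : ∀ t, Measurable (W t)) (hc : ∀ ω, Continuous (extendPath W ω)) {f : ℝ → ℝ}
    (hf : Continuous f) : Measurable fun ω => ∫ t in (0:ℝ)..1, f t * extendPath W ω t := by
  refine measurable_of_tendsto_metrizable
    (f := fun N ω => riemannSum N fun t => f t * extendPath W ω t) (fun N => ?_)
    (tendsto_pi_nhds.2 fun ω => tendsto_riemannSum (hf.mul (hc ω)))
  unfold riemannSum extendPath
  exact Finset.measurable_sum _ fun k _ => ((hW _).const_mul _).const_mul _

section BrownianMotion

variable {Ω : Type*} [MeasurableSpace Ω] {P : Measure Ω} {W : ℝ → Ω → ℝ}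

lemma IsStdBM.continuous_extendPath (h : IsStdBM P W) (ω : Ω) : Continuous (extendPath W ω) :=
  (h.2.1 ω).comp_continuous (by fun_prop) fun t => le_max_right t 0

lemma IsStdBM.map_riemannSum (h : IsStdBM P W) (f : ℝ → ℝ) (N : ℕ) :
    P.map (fun ω => riemannSum N fun t => f t * extendPath W ω t) = gaussianReal 0
      (riemannSum N fun s => riemannSum N fun t => f s * f t * min s t).toNNReal := by
  have h0 (k : Fin N) : (0:ℝ) ≤ (k:ℕ) / N := by positivity
  have e := h.2.2.2 N (fun k => (k:ℕ) / N) (fun k => (N:ℝ)⁻¹ * f (k / N)) h0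
  have e1 : (fun ω => riemannSum N fun t => f t * extendPath W ω t)
      = fun ω => ∑ k : Fin N, (N:ℝ)⁻¹ * f (k / N) * W (k / N) ω := by
    ext ω
    refine Finset.sum_congr rfl fun k _ => ?_
    simp only [extendPath, max_eq_left (h0 k)]
    ring
  have e2 : (riemannSum N fun s => riemannSum N fun t => f s * f t * min s t)
      = ∑ j : Fin N, ∑ k : Fin N, (N:ℝ)⁻¹ * f (j / N) * ((N:ℝ)⁻¹ * f (k / N))
          * min ((j:ℕ) / N : ℝ) ((k:ℕ) / N) := by
    simp only [riemannSum, Finset.mul_sum]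
    refine Finset.sum_congr rfl fun j _ => Finset.sum_congr rfl fun k _ => ?_
    ring
  rw [e1, e2, e]

/-- The integral of a Brownian path against a continuous weight is Gaussian. -/
lemma IsStdBM.map_integral_mul_extendPath [IsProbabilityMeasure P] (h : IsStdBM P W) {f : ℝ → ℝ}
    (hf : Continuous f) :
    P.map (fun ω => ∫ t in (0:ℝ)..1, f t * extendPath W ω t) = gaussianReal 0
      (∫ s in (0:ℝ)..1, ∫ t in (0:ℝ)..1, f s * f t * min s t).toNNReal := by
  have hX := measurable_integral_mul_extendPath h.1 h.continuous_extendPath hf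
  have hXN (N : ℕ) : Measurable fun ω => riemannSum N fun t => f t * extendPath W ω t := by
    unfold riemannSum extendPath
    exact Finset.measurable_sum _ fun k _ => ((h.1 _).const_mul _).const_mul _
  have := Measure.isProbabilityMeasure_map (μ := P) hX.aemeasurable
  refine Measure.ext_of_charFun (funext fun u => ?_)
  have hlim : Tendsto (fun N => charFun (P.map fun ω => riemannSum N fun t =>
      f t * extendPath W ω t) u) atTop
      (𝓝 (charFun (P.map fun ω => ∫ t in (0:ℝ)..1, f t * extendPath W ω t) u)) := by
    have e {Y : Ω → ℝ} (hY : Measurable Y) :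
        charFun (P.map Y) u = ∫ ω, Complex.exp (u * Y ω * Complex.I) ∂P := by
      rw [charFun_apply_real, integral_map hY.aemeasurable (by fun_prop)]
    simp_rw [e hX, e (hXN _)]
    refine tendsto_integral_of_dominated_convergence (fun _ => 1)
      (fun N => ?_) (integrable_const _) (fun N => ae_of_all _ fun ω => ?_)
      (ae_of_all _ fun ω => ?_)
    · have := hXN N
      exact Measurable.aestronglyMeasurable (by fun_prop)
    · rw [← Complex.ofReal_mul, Complex.norm_exp_ofReal_mul_I]
    · have := tendsto_riemannSum (hf.mul (h.continuous_extendPath ω))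
      exact (Complex.continuous_exp.tendsto _).comp
        (((Complex.continuous_ofReal.tendsto _).comp this).const_mul _ |>.mul_const _)
  refine tendsto_nhds_unique hlim ?_
  simp_rw [h.map_riemannSum, charFun_gaussianReal]
  have hv := (continuous_real_toNNReal.tendsto _).comp
    (tendsto_riemannSum_riemannSum (F := fun s t => f s * f t * min s t) (by
      unfold Function.uncurry; fun_prop))
  have hc : Continuous fun v : NNReal =>
      Complex.exp (u * (0:ℝ) * Complex.I - ((v:ℝ):ℂ) * u ^ 2 / 2) := by fun_prop
  exact (hc.tendsto _).comp hv

end BrownianMotion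

lemma sin_cosFreq (n : ℕ) : Real.sin (cosFreq n) = 0 := by
  have := Real.sin_nat_mul_pi (n + 1)
  rwa [Nat.cast_add_one] at this

lemma integral_cos_int_mul_pi_mul {k : ℤ} (hk : k ≠ 0) :
    ∫ t in (0:ℝ)..1, Real.cos (k * Real.pi * t) = 0 := by
  have hk' : (k:ℝ) * Real.pi ≠ 0 := mul_ne_zero (by exact_mod_cast hk) Real.pi_ne_zero
  rw [intervalIntegral.integral_comp_mul_left _ hk', integral_cos]
  simp [Real.sin_int_mul_pi]

lemma integral_cos_cosFreq (n : ℕ) : ∫ t in (0:ℝ)..1, Real.cos (cosFreq n * t) = 0 := by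
  have h := integral_cos_int_mul_pi_mul (k := n + 1) (by omega)
  push_cast at h
  exact h

lemma integral_cos_mul_cos (m n : ℕ) :
    ∫ t in (0:ℝ)..1, Real.cos (cosFreq m * t) * Real.cos (cosFreq n * t)
      = if m = n then 1 / 2 else 0 := by
  have hadd := integral_cos_int_mul_pi_mul (k := m + n + 2) (by omega)
  have e (t : ℝ) : Real.cos (cosFreq m * t) * Real.cos (cosFreq n * t)
      = 1 / 2 * Real.cos (((m - n : ℤ) : ℝ) * Real.pi * t)
        + 1 / 2 * Real.cos (((m + n + 2 : ℤ) : ℝ) * Real.pi * t) := by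
    have h1 : ((m - n : ℤ) : ℝ) * Real.pi * t = cosFreq m * t - cosFreq n * t := by
      unfold cosFreq; push_cast; ring
    have h2 : ((m + n + 2 : ℤ) : ℝ) * Real.pi * t = cosFreq m * t + cosFreq n * t := by
      unfold cosFreq; push_cast; ring
    rw [h1, h2, Real.cos_sub, Real.cos_add]
    ring
  simp_rw [e]
  rw [intervalIntegral.integral_add (Continuous.intervalIntegrable (by fun_prop) _ _)
    (Continuous.intervalIntegrable (by fun_prop) _ _), intervalIntegral.integral_const_mul,
    intervalIntegral.integral_const_mul, hadd]
  split_ifs with hmn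
  · simp [hmn]
  · rw [integral_cos_int_mul_pi_mul (by omega)]
    ring

lemma integral_cos_mul_min (n : ℕ) {s : ℝ} (hs : s ∈ Set.Icc (0:ℝ) 1) :
    ∫ t in (0:ℝ)..1, Real.cos (cosFreq n * t) * min s t
      = (Real.cos (cosFreq n * s) - 1) / cosFreq n ^ 2 := by
  have ha := (cosFreq_pos n).ne'
  have hc : Continuous fun t => Real.cos (cosFreq n * t) * min s t := by fun_prop
  have hl : ∫ t in (0:ℝ)..s, Real.cos (cosFreq n * t) * min s t
      = s * Real.sin (cosFreq n * s) / cosFreq n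
        + (Real.cos (cosFreq n * s) - 1) / cosFreq n ^ 2 := by
    have e : ∫ t in (0:ℝ)..s, Real.cos (cosFreq n * t) * min s t
        = ∫ t in (0:ℝ)..s, Real.cos (cosFreq n * t) * t := by
      refine intervalIntegral.integral_congr fun t ht => ?_
      rw [Set.uIcc_of_le hs.1] at ht
      simp only [min_eq_right ht.2]
    rw [e, intervalIntegral.integral_eq_sub_of_hasDerivAt (f := fun t =>
      t * Real.sin (cosFreq n * t) / cosFreq n + Real.cos (cosFreq n * t) / cosFreq n ^ 2)
      (fun t _ => ?_) (Continuous.intervalIntegrable (by fun_prop) _ _)]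
    · simp; ring
    · have hlin : HasDerivAt (fun t => cosFreq n * t) (cosFreq n) t := by
        simpa using (hasDerivAt_id t).const_mul (cosFreq n)
      have := (((hasDerivAt_id t).mul hlin.sin).div_const (cosFreq n)).add
        (hlin.cos.div_const (cosFreq n ^ 2))
      convert! this using 1
      simp only [id]
      field_simp
      ring
  have hr : ∫ t in s..1, Real.cos (cosFreq n * t) * min s t
      = - (s * Real.sin (cosFreq n * s) / cosFreq n) := by
    have e : ∫ t in s..1, Real.cos (cosFreq n * t) * min s t
        = ∫ t in s..1, Real.cos (cosFreq n * t) * s := by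
      refine intervalIntegral.integral_congr fun t ht => ?_
      rw [Set.uIcc_of_le hs.2] at ht
      simp only [min_eq_left ht.1]
    rw [e, intervalIntegral.integral_mul_const, intervalIntegral.integral_comp_mul_left _ ha,
      integral_cos, mul_one, sin_cosFreq, smul_eq_mul]
    field_simp
    ring
  rw [← intervalIntegral.integral_add_adjacent_intervals (hc.intervalIntegrable 0 s)
    (hc.intervalIntegrable s 1), hl, hr]
  ring

/-- The covariance kernel `min s t` is diagonal in the cosine basis. -/
lemma integral_integral_cos_sum {ι : Type*} [Fintype ι] {e : ι → ℕ} (he : e.Injective)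
    (c : ι → ℝ) :
    ∫ s in (0:ℝ)..1, ∫ t in (0:ℝ)..1, (∑ i, c i * (√2 * Real.cos (cosFreq (e i) * s)))
        * (∑ i, c i * (√2 * Real.cos (cosFreq (e i) * t))) * min s t
      = ∑ i, c i ^ 2 / cosFreq (e i) ^ 2 := by
  classical
  have h2 : √2 * √2 = 2 := Real.mul_self_sqrt zero_le_two
  have inner (s : ℝ) (hs : s ∈ Set.Icc (0:ℝ) 1) :
      ∫ t in (0:ℝ)..1, (∑ i, c i * (√2 * Real.cos (cosFreq (e i) * s)))
        * (∑ i, c i * (√2 * Real.cos (cosFreq (e i) * t))) * min s t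
      = ∑ i, ∑ j, 2 * c i * c j / cosFreq (e j) ^ 2 *
          (Real.cos (cosFreq (e i) * s) * Real.cos (cosFreq (e j) * s)
            - Real.cos (cosFreq (e i) * s)) := by
    simp_rw [mul_assoc, intervalIntegral.integral_const_mul, Finset.sum_mul]
    rw [intervalIntegral.integral_finsetSum
      fun i _ => Continuous.intervalIntegrable (by fun_prop) _ _]
    refine Finset.sum_congr rfl fun i _ => ?_
    rw [mul_assoc, mul_assoc, Finset.mul_sum, Finset.mul_sum, Finset.mul_sum]
    refine Finset.sum_congr rfl fun j _ => ?_
    simp_rw [mul_assoc, intervalIntegral.integral_const_mul]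
    rw [integral_cos_mul_min _ hs]
    linear_combination (c i * Real.cos (cosFreq (e i) * s) * c j *
      ((Real.cos (cosFreq (e j) * s) - 1) / cosFreq (e j) ^ 2)) * h2
  rw [intervalIntegral.integral_congr (g := fun s => ∑ i, ∑ j, 2 * c i * c j / cosFreq (e j) ^ 2 *
          (Real.cos (cosFreq (e i) * s) * Real.cos (cosFreq (e j) * s)
            - Real.cos (cosFreq (e i) * s)))
    (fun s hs => inner s (by rwa [Set.uIcc_of_le zero_le_one] at hs)),
    intervalIntegral.integral_finsetSum
      fun i _ => Continuous.intervalIntegrable (by fun_prop) _ _]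
  refine Finset.sum_congr rfl fun i _ => ?_
  rw [intervalIntegral.integral_finsetSum
      fun i _ => Continuous.intervalIntegrable (by fun_prop) _ _]
  have hterm (j : ι) : ∫ s in (0:ℝ)..1, 2 * c i * c j / cosFreq (e j) ^ 2 *
      (Real.cos (cosFreq (e i) * s) * Real.cos (cosFreq (e j) * s)
        - Real.cos (cosFreq (e i) * s))
      = if i = j then c j ^ 2 / cosFreq (e j) ^ 2 else 0 := by
    rw [intervalIntegral.integral_const_mul, intervalIntegral.integral_sub
      (Continuous.intervalIntegrable (by fun_prop) _ _)
      (Continuous.intervalIntegrable (by fun_prop) _ _), integral_cos_mul_cos,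
      integral_cos_cosFreq]
    simp only [he.eq_iff]
    split_ifs with hij
    · rw [hij]; ring
    · ring
  simp_rw [hterm]
  simp

section CosGaussian

variable {Ω : Type*} [MeasurableSpace Ω] {P : Measure Ω} {W : ℝ → Ω → ℝ}

lemma measurable_cosCoeff_extendPath (hW : ∀ t, Measurable (W t))
    (hc : ∀ ω, Continuous (extendPath W ω)) (n : ℕ) :
    Measurable fun ω => cosCoeff n (extendPath W ω) :=
  (measurable_integral_mul_extendPath hW hc (by fun_prop)).const_mul _

lemma IsStdBM.map_sum_cosCoeff [IsProbabilityMeasure P] (h : IsStdBM P W) {ι : Type*} [Fintype ι]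
    {e : ι → ℕ} (he : e.Injective) (c : ι → ℝ) :
    P.map (fun ω => ∑ i, c i * cosCoeff (e i) (extendPath W ω))
      = gaussianReal 0 (∑ i, c i ^ 2 / cosFreq (e i) ^ 2).toNNReal := by
  have hX (ω : Ω) : ∑ i, c i * cosCoeff (e i) (extendPath W ω)
      = ∫ t in (0:ℝ)..1, (∑ i, c i * (√2 * Real.cos (cosFreq (e i) * t))) * extendPath W ω t := by
    have hc := h.continuous_extendPath ω
    simp_rw [Finset.sum_mul]
    rw [intervalIntegral.integral_finsetSum
      fun i _ => Continuous.intervalIntegrable (by fun_prop) _ _]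
    simp_rw [mul_assoc, intervalIntegral.integral_const_mul]
    rfl
  simp_rw [hX]
  rw [h.map_integral_mul_extendPath (by fun_prop), integral_integral_cos_sum he]

lemma IsStdBM.map_cosCoeff [IsProbabilityMeasure P] (h : IsStdBM P W) (n : ℕ) :
    P.map (fun ω => cosCoeff n (extendPath W ω)) = gaussianReal 0 (cosVar n) := by
  have := h.map_sum_cosCoeff (e := fun _ : Unit => n) (Function.injective_of_subsingleton _)
    fun _ => 1
  simp only [Finset.univ_unique, Finset.sum_singleton, one_mul, one_pow] at this
  rw [this, ← coe_cosVar, Real.toNNReal_coe]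

lemma IsStdBM.isCosGaussian [IsProbabilityMeasure P] (h : IsStdBM P W) :
    IsCosGaussian P fun n ω => cosCoeff n (extendPath W ω) where
  measurable := measurable_cosCoeff_extendPath h.1 h.continuous_extendPath
  law := h.map_cosCoeff
  indep := by
    have hm := measurable_cosCoeff_extendPath h.1 h.continuous_extendPath
    rw [iIndepFun_iff_finset]
    intro s
    refine (iIndepFun_iff_charFun_pi fun i : s => (hm i).aemeasurable).2 ?_
    intro t
    have hvec : Measurable fun ω =>
        WithLp.toLp 2 fun i : s => cosCoeff i (extendPath W ω) := by
      have := measurable_pi_lambda (fun ω (i : s) => cosCoeff i (extendPath W ω)) fun i => hm i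
      fun_prop
    have hsum : Measurable fun ω => ∑ i : s, t i * cosCoeff i (extendPath W ω) :=
      Finset.measurable_sum _ fun i _ => (hm i).const_mul _
    have e : charFun (P.map fun ω => WithLp.toLp 2 fun i : s => cosCoeff i (extendPath W ω)) t
        = charFun (P.map fun ω => ∑ i : s, t i * cosCoeff i (extendPath W ω)) 1 := by
      rw [charFun_apply, charFun_apply_real, integral_map hvec.aemeasurable (by fun_prop),
        integral_map hsum.aemeasurable (by fun_prop)]
      simp [PiLp.inner_apply]
    have hnn : 0 ≤ ∑ i : s, t i ^ 2 / cosFreq i ^ 2 := by positivity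
    refine e.trans ?_
    rw [h.map_sum_cosCoeff (e := fun i : s => (i : ℕ)) Subtype.val_injective, charFun_gaussianReal,
      Real.coe_toNNReal _ hnn]
    simp only [h.map_cosCoeff, charFun_gaussianReal, coe_cosVar]
    rw [← Complex.exp_sum]
    congr 1
    push_cast
    simp only [mul_zero, zero_mul, zero_sub, one_pow, mul_one, Finset.sum_neg_distrib,
      Finset.sum_div]
    congr 1
    refine Finset.sum_congr rfl fun i _ => ?_
    ring

end CosGaussian

lemma extendPath_eq {Ω : Type*} (W : ℝ → Ω → ℝ) (ω : Ω) {u : ℝ}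
    (hu : u ∈ Set.uIcc (0:ℝ) 1) : extendPath W ω u = W u ω := by
  rw [Set.uIcc_of_le zero_le_one] at hu
  rw [extendPath, max_eq_left hu.1]

theorem stmt_5 {Ω : Type*} [MeasurableSpace Ω] (P : Measure Ω) [IsProbabilityMeasure P]
    (W₁ W₂ : ℝ → Ω → ℝ) (hW₁ : IsStdBM P W₁) (hW₂ : IsStdBM P W₂)
    (hindep : IndepFun (fun ω => fun t => W₁ t ω) (fun ω => fun t => W₂ t ω) P)
    (Y₁₁ Y₁₂ Y₂₂ : Ω → ℝ)
    (hY₁₁ : ∀ ω, Y₁₁ ω = (∫ u in (0:ℝ)..1, (W₁ u ω) ^ 2) - (∫ u in (0:ℝ)..1, W₁ u ω) ^ 2)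
    (hY₂₂ : ∀ ω, Y₂₂ ω = (∫ u in (0:ℝ)..1, (W₂ u ω) ^ 2) - (∫ u in (0:ℝ)..1, W₂ u ω) ^ 2)
    (hY₁₂ : ∀ ω, Y₁₂ ω = (∫ u in (0:ℝ)..1, W₁ u ω * W₂ u ω) -
      (∫ u in (0:ℝ)..1, W₁ u ω) * (∫ u in (0:ℝ)..1, W₂ u ω))
    (ρ : Ω → ℝ) (hρ : ∀ ω, ρ ω = Y₁₂ ω / Real.sqrt (Y₁₁ ω * Y₂₂ ω)) :
    ∫ ω, (ρ ω) ^ 2 ∂P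
      = ∫ v in Set.Ioi (0:ℝ), ∫ u in (0:ℝ)..v,
          (u * v * Real.sqrt (u * v) /
              ((v ^ 2 - u ^ 2) * Real.sqrt (Real.sinh u * Real.sinh v))) *
            (1 / (u * Real.tanh u) - 1 / (v * Real.tanh v) - 1 / u ^ 2 + 1 / v ^ 2) := by
  set ξ : ℕ → Ω → ℝ := fun n ω => cosCoeff n (extendPath W₁ ω)
  set η : ℕ → Ω → ℝ := fun n ω => cosCoeff n (extendPath W₂ ω)
  have hc₁ := hW₁.continuous_extendPath
  have hc₂ := hW₂.continuous_extendPath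
  have hS (ω : Ω) : HasSum (fun n => ξ n ω ^ 2) (Y₁₁ ω) := by
    have h := hasSum_cosCoeff_sq (hc₁ ω)
    rwa [intervalIntegral.integral_congr fun u hu => by rw [extendPath_eq W₁ ω hu],
      intervalIntegral.integral_congr fun u hu => extendPath_eq W₁ ω hu, ← hY₁₁ ω] at h
  have hT (ω : Ω) : HasSum (fun n => η n ω ^ 2) (Y₂₂ ω) := by
    have h := hasSum_cosCoeff_sq (hc₂ ω)
    rwa [intervalIntegral.integral_congr fun u hu => by rw [extendPath_eq W₂ ω hu],
      intervalIntegral.integral_congr fun u hu => extendPath_eq W₂ ω hu, ← hY₂₂ ω] at h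
  have hZ (ω : Ω) : HasSum (fun n => ξ n ω * η n ω) (Y₁₂ ω) := by
    have h := hasSum_cosCoeff_mul (hc₁ ω) (hc₂ ω)
    rwa [intervalIntegral.integral_congr fun u hu => by
        rw [extendPath_eq W₁ ω hu, extendPath_eq W₂ ω hu],
      intervalIntegral.integral_congr fun u hu => extendPath_eq W₁ ω hu,
      intervalIntegral.integral_congr fun u hu => extendPath_eq W₂ ω hu, ← hY₁₂ ω] at h
  have hmeas {W : ℝ → Ω → ℝ} (hc : ∀ ω, Continuous (extendPath W ω)) (n : ℕ) :
      Measurable[MeasurableSpace.comap (fun ω t => W t ω) inferInstance]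
        fun ω => cosCoeff n (extendPath W ω) :=
    @measurable_cosCoeff_extendPath Ω (MeasurableSpace.comap (fun ω t => W t ω) inferInstance) W
      (fun t => (measurable_pi_apply t).comp (comap_measurable fun ω t => W t ω)) hc n
  have hsq (ω : Ω) : ρ ω ^ 2 = Y₁₂ ω ^ 2 / (Y₁₁ ω * Y₂₂ ω) := by
    rw [hρ, div_pow, Real.sq_sqrt (mul_nonneg ((hS ω).nonneg fun n => sq_nonneg _)
      ((hT ω).nonneg fun n => sq_nonneg _))]
  simp_rw [hsq]
  exact integral_triangle_of_hasSum (hW₁.isCosGaussian.integrableOn_shareDensity hS)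
    (hasSum_sq_integral_shareDensity hW₁.isCosGaussian hW₂.isCosGaussian hS hT hZ hindep
      (hmeas hc₁) (hmeas hc₂))
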